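/- Let K be a field, and let A and B be finite-dimensional central simple K-algebras (i.e. K-algebras that are simple rings with center exactly K). Let D be a finite-dimensional central division K-algebra such that for some positive integer n the matrix algebra Mₙ(D) is isomorphic as a K-algebra to B ⊗_K A^op (so that D represents the Brauer class [B] − [A]). Then there exists an injective K-algebra homomorphism A → B if and only if dim_K(D) · dim_K(A) divides dim_K(B). -/

import Mathlib

open scoped TensorProduct

open scoped Matrix.Module in
theorem sch_dvd (K D V : Type*) [Field K] [DivisionRing D] [Algebra K D] [FiniteDimensional K D]
    [AddCommGroup V] [Module K V] [FiniteDimensional K V] (n : ℕ) (hn : 0 < n)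
    (ρ : Matrix (Fin n) (Fin n) D →ₐ[K] Module.End K V) :
    n * Module.finrank K D ∣ Module.finrank K V := by
  let i1 : Module (Matrix (Fin n) (Fin n) D) V := Module.compHom V ρ.toRingHom
  let i2 : Module D V := Module.compHom V (Matrix.scalar (α := D) (Fin n))
  have i3 : IsScalarTower D (Matrix (Fin n) (Fin n) D) V :=
    MatrixModCat.isScalarTower_toModuleCat D (ModuleCat.of (Matrix (Fin n) (Fin n) D) V)
  have i4 : IsScalarTower K D V := by
    refine ⟨fun k d v => ?_⟩
    change ρ (Matrix.scalar (Fin n) (k • d)) v = k • (ρ (Matrix.scalar (Fin n) d) v)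
    have : Matrix.scalar (Fin n) (k • d) = k • Matrix.scalar (Fin n) d := by
      ext i j; by_cases h : i = j <;> simp [Matrix.diagonal, h]
    rw [this, map_smul]; rfl
  have i5 : Module.Finite D V := Module.Finite.of_restrictScalars_finite K D V
  let P := MatrixModCat.toModuleCatObj D V (⟨0, hn⟩ : Fin n)
  let e₀ := toModuleCatFromModuleCatLinearEquiv D
    (ModuleCat.of (Matrix (Fin n) (Fin n) D) V) (⟨0, hn⟩ : Fin n)
  let e : V ≃ₗ[D] (Fin n → P) :=
    { e₀.toAddEquiv with
      map_smul' := fun d v => by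
        have := e₀.map_smul (Matrix.scalar (Fin n) d) v
        refine this.trans ?_
        exact Matrix.Module.scalar_smul d (e₀ v) }
  rw [← Module.finrank_mul_finrank K D V, e.finrank_eq, Module.finrank_pi_fintype]
  simp only [Finset.sum_const, Finset.card_univ, Fintype.card_fin, smul_eq_mul]
  exact ⟨Module.finrank D P, by ring⟩

theorem sch_iso (K B V : Type*) [Field K] [Ring B] [Algebra K B] [FiniteDimensional K B]
    [IsSimpleRing B] [AddCommGroup V] [Module K V] [FiniteDimensional K V]
    [Module B V] [IsScalarTower K B V]
    (h : Module.finrank K V = Module.finrank K B) : Nonempty (V ≃ₗ[B] B) := by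
  have : IsArtinianRing B := IsArtinianRing.of_finite K B
  have : Module.Finite B V := Module.Finite.of_restrictScalars_finite K B V
  obtain ⟨l, _, S, hS, ⟨e₁⟩⟩ := (IsSimpleRing.isIsotypic B B).linearEquiv_fun
  have hV : IsIsotypicOfType B V S := by
    intro m hm
    obtain ⟨I, ⟨e⟩⟩ := IsSemisimpleRing.exists_linearEquiv_ideal_of_isSimpleModule B m
    have := IsSimpleModule.congr e.symm
    exact ⟨e.trans ((IsSimpleRing.isIsotypic B B) S I).some⟩
  obtain ⟨k, ⟨e₂⟩⟩ := hV.linearEquiv_fun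
  have : Nontrivial S := IsSimpleModule.nontrivial B S
  have h1 := (e₁.restrictScalars K).finrank_eq
  have h2 := (e₂.restrictScalars K).finrank_eq
  rw [Module.finrank_pi_fintype] at h1 h2
  simp only [Finset.sum_const, Finset.card_univ, Fintype.card_fin, smul_eq_mul] at h1 h2
  have hpos : 0 < Module.finrank K S := Module.finrank_pos
  have hkl : k = l := Nat.eq_of_mul_eq_mul_right hpos (by rw [← h1, ← h2, h])
  subst hkl
  exact ⟨e₂.trans e₁.symm⟩

theorem sch_hom (K A B V : Type*) [Field K] [Ring A] [Algebra K A] [Ring B] [Algebra K B]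
    [FiniteDimensional K B]
    [IsSimpleRing B] [AddCommGroup V] [Module K V] [FiniteDimensional K V]
    (ρ : B ⊗[K] Aᵐᵒᵖ →ₐ[K] Module.End K V)
    (h : Module.finrank K V = Module.finrank K B) : Nonempty (A →ₐ[K] B) := by
  let i1 : Module B V :=
    Module.compHom V (ρ.comp Algebra.TensorProduct.includeLeft : B →ₐ[K] _).toRingHom
  have hsm : ∀ (b : B) (v : V), b • v = ρ (b ⊗ₜ 1) v := fun _ _ => rfl
  have i2 : IsScalarTower K B V := by
    refine ⟨fun k b v => ?_⟩
    rw [hsm, hsm, ← TensorProduct.smul_tmul', map_smul]; rfl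
  obtain ⟨φ⟩ := sch_iso K B V h
  let T : A → V → V := fun a v => ρ (1 ⊗ₜ MulOpposite.op a) v
  have hT : ∀ a (b : B) v, T a (b • v) = b • T a v := by
    intro a b v
    simp only [T, hsm]
    rw [← Module.End.mul_apply, ← Module.End.mul_apply, ← map_mul, ← map_mul]
    simp
  let f : A → B := fun a => φ (T a (φ.symm 1))
  have hf : ∀ a, T a (φ.symm 1) = f a • φ.symm 1 := by
    intro a
    apply φ.injective
    simp [f]
  have hlin : ∀ (k : K) a, f (k • a) = k • f a := by
    intro k a
    have : T (k • a) (φ.symm 1) = k • T a (φ.symm 1) := by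
      simp [T]
    simp only [f, this]
    exact (φ.restrictScalars K).map_smul k _
  refine ⟨AlgHom.ofLinearMap { toFun := f, map_add' := ?_, map_smul' := hlin } ?_ ?_⟩
  · intro a b
    simp [f, T, TensorProduct.tmul_add]
  · have : (ρ (1 ⊗ₜ 1)) = 1 := map_one ρ
    simp [f, T, this]
  · intro a b
    have : T (a * b) (φ.symm 1) = T b (T a (φ.symm 1)) := by
      simp only [T]
      rw [← Module.End.mul_apply, ← map_mul]
      simp
    change φ (T (a * b) (φ.symm 1)) = f a * f b
    rw [this, hf, hT, map_smul]
    rfl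

open scoped Matrix.Module in
theorem sch_rep (K D : Type*) [Field K] [DivisionRing D] [Algebra K D] [FiniteDimensional K D]
    (n k : ℕ) :
    Nonempty (Matrix (Fin n) (Fin n) D →ₐ[K] Module.End K (Fin n → Fin k → D)) :=
  ⟨Algebra.lsmul K K (Fin n → Fin k → D)⟩

theorem schofield_embedding_iff
    (K : Type*) [Field K]
    (A B D : Type*) [Ring A] [Algebra K A] [Ring B] [Algebra K B]
    [DivisionRing D] [Algebra K D]
    [FiniteDimensional K A] [FiniteDimensional K B] [FiniteDimensional K D]
    [Algebra.IsCentral K A] [IsSimpleRing A]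
    [Algebra.IsCentral K B] [IsSimpleRing B]
    [Algebra.IsCentral K D]
    (n : ℕ) (hn : 0 < n)
    (e : Matrix (Fin n) (Fin n) D ≃ₐ[K] (B ⊗[K] Aᵐᵒᵖ)) :
    (∃ f : A →ₐ[K] B, Function.Injective f) ↔
      Module.finrank K D * Module.finrank K A ∣ Module.finrank K B := by
  have hop : Module.finrank K Aᵐᵒᵖ = Module.finrank K A :=
    (MulOpposite.opLinearEquiv K : A ≃ₗ[K] Aᵐᵒᵖ).finrank_eq.symm
  have hdim : n * n * Module.finrank K D = Module.finrank K B * Module.finrank K A := by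
    have h := e.toLinearEquiv.finrank_eq
    rw [Module.finrank_matrix, Module.finrank_tensorProduct, hop] at h
    simpa using h
  have hD : 0 < Module.finrank K D := Module.finrank_pos
  have hA : 0 < Module.finrank K A := Module.finrank_pos
  generalize hd : Module.finrank K D = d at *
  generalize ha : Module.finrank K A = a at *
  constructor
  · rintro ⟨f, -⟩
    let ρ : B ⊗[K] Aᵐᵒᵖ →ₐ[K] Module.End K B :=
      (AlgHom.mulLeftRight K B).comp
        (Algebra.TensorProduct.map (AlgHom.id K B) f.op)
    obtain ⟨k, hk⟩ := sch_dvd K D B n hn (ρ.comp e.toAlgHom)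
    rw [hd] at hk
    rw [hk] at hdim ⊢
    have : n = k * a := by
      apply Nat.eq_of_mul_eq_mul_left (Nat.mul_pos hn hD)
      linarith
    exact ⟨k * k, by rw [this]; ring⟩
  · rintro ⟨m, hm⟩
    rw [hm] at hdim
    have h1 : n ^ 2 = a ^ 2 * m := by
      apply Nat.eq_of_mul_eq_mul_right hD
      linarith
    obtain ⟨k, hk⟩ := (Nat.pow_dvd_pow_iff two_ne_zero).1 ⟨m, h1⟩
    have hmk : m = k ^ 2 := by
      apply Nat.eq_of_mul_eq_mul_left (pow_pos hA 2)
      rw [← h1, hk]; ring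
    obtain ⟨σ⟩ := sch_rep K D n k
    obtain ⟨f⟩ := sch_hom K A B (Fin n → Fin k → D) (σ.comp e.symm.toAlgHom) (by
      simp only [Module.finrank_pi_fintype, Finset.sum_const, Finset.card_univ, Fintype.card_fin,
        smul_eq_mul]
      rw [hd, hm, hk, hmk]; ring)
    exact ⟨f, f.toRingHom.injective⟩
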